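/- Let R be a commutative ring with identity and consider the full matrix algebra Mₙ(R). If R is equationally Noetherian, then Mₙ(R) is equationally Noetherian as an R-algebra. -/

import Mathlib

/-- Terms (polynomial expressions) over an `R`-algebra `A` in `n` variables, built
from constants of `A`, variables, addition, multiplication, and `R`-scalars. -/
inductive AlgTerm (R A : Type*) (n : ℕ) where
  | const : A → AlgTerm R A n
  | var : Fin n → AlgTerm R A n
  | add : AlgTerm R A n → AlgTerm R A n → AlgTerm R A n
  | mul : AlgTerm R A n → AlgTerm R A n → AlgTerm R A n
  | smul : R → AlgTerm R A n → AlgTerm R A n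

/-- Evaluation of a term at a point of `Aⁿ`. -/
def AlgTerm.eval {R A : Type*} [Semiring R] [NonUnitalNonAssocRing A] [Module R A]
    {n : ℕ} (v : Fin n → A) : AlgTerm R A n → A
  | const a => a
  | var i => v i
  | add s t => AlgTerm.eval v s + AlgTerm.eval v t
  | mul s t => AlgTerm.eval v s * AlgTerm.eval v t
  | smul r t => r • AlgTerm.eval v t

/-- `R` is equationally Noetherian. -/
def RingEqNoeth (R : Type*) [CommRing R] : Prop :=
  ∀ (n : ℕ) (S : Set (MvPolynomial (Fin n) R)),
    ∃ T ⊆ S, T.Finite ∧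
      {a : Fin n → R | ∀ f ∈ S, MvPolynomial.eval a f = 0} =
      {a : Fin n → R | ∀ f ∈ T, MvPolynomial.eval a f = 0}

/-- The `R`-algebra `A` is equationally Noetherian. -/
def AlgEqNoeth (R A : Type*) [CommRing R] [NonUnitalNonAssocRing A] [Module R A] :
    Prop :=
  ∀ (n : ℕ) (S : Set (AlgTerm R A n)),
    ∃ T ⊆ S, T.Finite ∧
      {a : Fin n → A | ∀ t ∈ S, AlgTerm.eval a t = 0} =
      {a : Fin n → A | ∀ t ∈ T, AlgTerm.eval a t = 0}

theorem AlgTerm.exists_poly {R : Type*} [CommRing R] {n m N : ℕ}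
    (e : Fin m × Fin n × Fin n ≃ Fin N) (t : AlgTerm R (Matrix (Fin n) (Fin n) R) m) :
    ∃ P : Fin n → Fin n → MvPolynomial (Fin N) R,
      ∀ (a : Fin m → Matrix (Fin n) (Fin n) R) (i j : Fin n),
        MvPolynomial.eval (fun k => a (e.symm k).1 (e.symm k).2.1 (e.symm k).2.2) (P i j)
          = AlgTerm.eval a t i j := by
  induction t with
  | const c => exact ⟨fun i j => MvPolynomial.C (c i j), by simp [AlgTerm.eval]⟩
  | var k => exact ⟨fun i j => MvPolynomial.X (e (k, i, j)), by simp [AlgTerm.eval]⟩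
  | add s t hs ht =>
    obtain ⟨P, hP⟩ := hs
    obtain ⟨Q, hQ⟩ := ht
    exact ⟨fun i j => P i j + Q i j, by simp [AlgTerm.eval, hP, hQ]⟩
  | mul s t hs ht =>
    obtain ⟨P, hP⟩ := hs
    obtain ⟨Q, hQ⟩ := ht
    exact ⟨fun i j => ∑ l, P i l * Q l j, by simp [AlgTerm.eval, hP, hQ, Matrix.mul_apply]⟩
  | smul r t ht =>
    obtain ⟨Q, hQ⟩ := ht
    exact ⟨fun i j => MvPolynomial.C r * Q i j, by simp [AlgTerm.eval, hQ]⟩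

/-- If `R` is an equationally Noetherian commutative ring, then the matrix algebra
`Mₙ(R)` is equationally Noetherian as an `R`-algebra. -/
theorem stmt10 {R : Type*} [CommRing R] (n : ℕ) (hR : RingEqNoeth R) :
    AlgEqNoeth R (Matrix (Fin n) (Fin n) R) := by
  intro m S
  let e := Fintype.equivFin (Fin m × Fin n × Fin n)
  choose P hP using fun t : AlgTerm R (Matrix (Fin n) (Fin n) R) m =>
    AlgTerm.exists_poly e t
  obtain ⟨T', hT'S, hfin, hEq⟩ := hR _ {f | ∃ t ∈ S, ∃ i j, f = P t i j}
  have hex : ∀ f, ∃ t, f ∈ T' → t ∈ S ∧ ∃ i j, f = P t i j := by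
    intro f
    by_cases hf : f ∈ T'
    · obtain ⟨t, ht, hij⟩ := hT'S hf
      exact ⟨t, fun _ => ⟨ht, hij⟩⟩
    · exact ⟨AlgTerm.const 0, fun h => absurd h hf⟩
  choose g hg using hex
  refine ⟨g '' T', ?_, hfin.image g, ?_⟩
  · rintro _ ⟨f, hf, rfl⟩
    exact (hg _ hf).1
  ext a
  constructor
  · rintro h _ ⟨f, hf, rfl⟩
    exact h _ ((hg _ hf).1)
  · intro h
    have key : (fun k => a (e.symm k).1 (e.symm k).2.1 (e.symm k).2.2) ∈
        {a | ∀ f ∈ T', MvPolynomial.eval a f = 0} := by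
      intro f hf
      obtain ⟨i, j, hij⟩ := (hg _ hf).2
      have h0 := h _ (Set.mem_image_of_mem g hf)
      conv_lhs => rw [hij]
      rw [hP, h0]
      rfl
    rw [← hEq] at key
    intro t ht
    ext i j
    rw [← hP]
    exact key _ ⟨t, ht, i, j, rfl⟩
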